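/- arXiv:2011.07767 — 2 statements merged into one kernel-verified Lean document; each statement's English description precedes it below -/
import Mathlib

section
/- Let q, z, c be complex numbers with |q| < 1 and |cq| < 1 (and such that no factor (zq;q)_n vanishes). Then ∑_{n=1}^∞ ( z^n c^n q^{n^2} ) / ( (zq;q)_n (cq;q)_n ) = z · ∑_{n=1}^∞ (cq)^n / (zq;q)_n. -/
/-- The finite q-Pochhammer symbol `(A;q)_n = (1-A)(1-Aq)⋯(1-Aq^{n-1})`. -/
noncomputable def qPoch (q A : ℂ) (n : ℕ) : ℂ := ∏ k ∈ Finset.range n, (1 - A * q ^ k)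

/-- The infinite q-Pochhammer symbol `(A;q)_∞ = ∏_{k≥0} (1 - A q^k)`. -/
noncomputable def qPochInf (q A : ℂ) : ℂ := ∏' k : ℕ, (1 - A * q ^ k)

lemma qPoch_succ (q A : ℂ) (n : ℕ) : qPoch q A (n + 1) = qPoch q A n * (1 - A * q ^ n) :=
  Finset.prod_range_succ _ _

lemma qPoch_succ_left (q A : ℂ) (n : ℕ) :
    qPoch q A (n + 1) = (1 - A) * qPoch q (A * q) n := by
  simp only [qPoch, Finset.prod_range_succ', pow_zero, mul_one]
  rw [mul_comm]
  congr 1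
  exact Finset.prod_congr rfl fun k _ => by ring

lemma qPoch_ne_zero {q z : ℂ} (hz : ∀ n : ℕ, 1 - z * q ^ (n + 1) ≠ 0) (n : ℕ) :
    qPoch q (z * q) n ≠ 0 :=
  Finset.prod_ne_zero_iff.2 fun k _ => by
    have := hz k
    rwa [pow_succ', ← mul_assoc] at this

lemma one_sub_mul_pow_succ_ne_zero {q c : ℂ} (hq : ‖q‖ < 1) (hcq : ‖c * q‖ < 1) (n : ℕ) :
    1 - c * q ^ (n + 1) ≠ 0 := by
  intro h
  have h1 : c * q * q ^ n = 1 := by linear_combination -h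
  have h2 : ‖c * q * q ^ n‖ < 1 := by
    rw [norm_mul, norm_pow]
    exact mul_lt_one_of_nonneg_of_lt_one_left (norm_nonneg _) hcq
      (pow_le_one₀ (norm_nonneg _) hq.le)
  rw [h1, norm_one] at h2
  exact lt_irrefl _ h2

lemma tendsto_mul_pow_add {q : ℂ} (hq : ‖q‖ < 1) (A : ℂ) (k : ℕ) :
    Filter.Tendsto (fun n : ℕ => A * q ^ (n + k)) Filter.atTop (nhds 0) := by
  simpa using ((tendsto_pow_atTop_nhds_zero_of_norm_lt_one hq).comp
    (Filter.tendsto_add_atTop_nat k)).const_mul A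

/-- The ratio test in multiplicative form, allowing vanishing terms. -/
lemma summable_of_eq_mul_of_tendsto {f r : ℕ → ℂ} {l : ℂ} (h : ∀ n, f (n + 1) = r n * f n)
    (hr : Filter.Tendsto r Filter.atTop (nhds l)) (hl : ‖l‖ < 1) : Summable f := by
  obtain ⟨a, ha, ha1⟩ := exists_between hl
  refine summable_of_ratio_norm_eventually_le (r := a) ha1 ?_
  filter_upwards [hr.norm.eventually_lt_const ha] with n hn
  rw [h, norm_mul]
  exact mul_le_mul_of_nonneg_right hn.le (norm_nonneg _)

lemma summable_pow_div_qPoch {q z c : ℂ} (hq : ‖q‖ < 1) (hcq : ‖c * q‖ < 1) :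
    Summable fun n : ℕ => (c * q) ^ (n + 1) / qPoch q (z * q) (n + 1) := by
  refine summable_of_eq_mul_of_tendsto (r := fun n => c * q / (1 - z * q ^ (n + 2)))
    (l := c * q) (fun n => ?_) ?_ hcq
  · rw [qPoch_succ _ _ (n + 1), show z * q * q ^ (n + 1) = z * q ^ (n + 2) by ring,
      pow_succ _ (n + 1), div_mul_div_comm]
    congr 1 <;> ring
  · have h := (tendsto_const_nhds (x := c * q)).div
      ((tendsto_const_nhds (x := (1 : ℂ))).sub (tendsto_mul_pow_add hq z 2)) (by simp)
    rwa [sub_zero, div_one] at h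

/-- The general term of the Durfee-square type series. -/
noncomputable def durfeeTerm (q z c : ℂ) (n : ℕ) : ℂ :=
  (z ^ n * c ^ n * q ^ (n ^ 2)) / (qPoch q (z * q) n * qPoch q (c * q) n)

lemma durfeeTerm_succ (q z c : ℂ) (n : ℕ) :
    durfeeTerm q z c (n + 1) = z * c * q ^ (2 * n + 1) /
      ((1 - z * q ^ (n + 1)) * (1 - c * q ^ (n + 1))) * durfeeTerm q z c n := by
  rw [durfeeTerm, durfeeTerm, qPoch_succ, qPoch_succ, div_mul_div_comm]
  congr 1 <;> ring

lemma summable_durfeeTerm {q : ℂ} (hq : ‖q‖ < 1) (z c : ℂ) : Summable (durfeeTerm q z c) := by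
  refine summable_of_eq_mul_of_tendsto (l := 0) (durfeeTerm_succ q z c) ?_ (by simp)
  have h1 := (tendsto_const_nhds (x := (1 : ℂ))).sub (tendsto_mul_pow_add hq z 1)
  have h2 := (tendsto_const_nhds (x := (1 : ℂ))).sub (tendsto_mul_pow_add hq c 1)
  have h3 := (tendsto_mul_pow_add hq (z * c) 0).mul (tendsto_mul_pow_add hq 1 1)
  have h4 := h3.div (h1.mul h2) (by simp)
  simp only [mul_zero, zero_div] at h4
  refine h4.congr fun n => ?_
  simp only [Pi.div_apply]
  congr 1
  ring

/-- The series `∑_{n ≥ 1} (cq)^n / (zq;q)_n`. -/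
noncomputable def fineSum (q z c : ℂ) : ℂ :=
  ∑' n : ℕ, (c * q) ^ (n + 1) / qPoch q (z * q) (n + 1)

lemma fineSum_functional_equation {q z c : ℂ} (hq : ‖q‖ < 1) (hcq : ‖c * q‖ < 1)
    (hz : ∀ n : ℕ, 1 - z * q ^ (n + 1) ≠ 0) :
    (1 - z * q) * (1 - c * q) * fineSum q z c
      = c * q * (1 + z * q * fineSum q (z * q) (c * q)) := by
  have hs := summable_pow_div_qPoch (z := z) hq hcq
  have hz0 : 1 - z * q ≠ 0 := by simpa using hz 0
  have hU : fineSum q z c = c * q / (1 - z * q)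
      + ∑' n : ℕ, (c * q) ^ (n + 1 + 1) / qPoch q (z * q) (n + 1 + 1) := by
    rw [fineSum, hs.tsum_eq_zero_add]
    simp [qPoch]
  have hs' : Summable fun n : ℕ => (c * q) ^ (n + 1 + 1) / qPoch q (z * q) (n + 1 + 1) :=
    (summable_nat_add_iff (f := fun n => (c * q) ^ (n + 1) / qPoch q (z * q) (n + 1)) 1).2 hs
  have key : ∑' n : ℕ, (c * q) ^ (n + 1 + 1) / qPoch q (z * q) (n + 1 + 1)
        - c * q * fineSum q z c
      = c * q * (z * q) / (1 - z * q) * fineSum q (z * q) (c * q) := by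
    rw [fineSum, fineSum, ← tsum_mul_left, ← tsum_mul_left,
      ← hs'.tsum_sub (hs.mul_left _)]
    refine tsum_congr fun n => ?_
    have h1 := qPoch_ne_zero hz (n + 1)
    have h2 : 1 - z * q * q ^ (n + 1) ≠ 0 := by
      have := hz (n + 1)
      rwa [pow_succ', ← mul_assoc] at this
    have h3 : qPoch q (z * q * q) (n + 1)
        = qPoch q (z * q) (n + 1) * (1 - z * q * q ^ (n + 1)) / (1 - z * q) := by
      rw [eq_div_iff hz0, ← qPoch_succ, qPoch_succ_left _ _ (n + 1), mul_comm]
    rw [h3, qPoch_succ _ _ (n + 1), mul_pow (c * q) q, pow_succ (c * q) (n + 1)]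
    generalize qPoch q (z * q) (n + 1) = P at h1 ⊢
    generalize (c * q) ^ (n + 1) = x
    generalize q ^ (n + 1) = y at h2 ⊢
    generalize 1 - z * q = a at hz0 ⊢
    generalize hd : 1 - z * q * y = d at h2 ⊢
    field_simp
    rw [← hd]
    ring
  have hk : (1 - c * q) * fineSum q z c = c * q / (1 - z * q)
      + c * q * (z * q) / (1 - z * q) * fineSum q (z * q) (c * q) := by
    linear_combination hU + key
  rw [mul_assoc, hk]
  field_simp

lemma mul_fineSum_eq_sum_add {q z c : ℂ} (hq : ‖q‖ < 1) (hcq : ‖c * q‖ < 1)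
    (hz : ∀ n : ℕ, 1 - z * q ^ (n + 1) ≠ 0) (N : ℕ) :
    z * fineSum q z c = ∑ n ∈ Finset.range N, durfeeTerm q z c (n + 1)
      + durfeeTerm q z c N * (z * q ^ N * fineSum q (z * q ^ N) (c * q ^ N)) := by
  induction N with
  | zero => simp [durfeeTerm, qPoch]
  | succ N ih =>
    have h1 := hz N
    have h2 := one_sub_mul_pow_succ_ne_zero hq hcq N
    have hc : ‖c * q ^ N * q‖ < 1 := by
      rw [mul_right_comm, norm_mul, norm_pow]
      exact mul_lt_one_of_nonneg_of_lt_one_left (norm_nonneg _) hcq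
        (pow_le_one₀ (norm_nonneg _) hq.le)
    have hf := fineSum_functional_equation (z := z * q ^ N) hq hc fun n => by
      have := hz (N + n)
      rwa [mul_assoc, ← pow_add, ← add_assoc]
    simp only [mul_assoc _ (q ^ N) q, ← pow_succ] at hf
    have hg : fineSum q (z * q ^ N) (c * q ^ N) = c * q ^ (N + 1) *
        (1 + z * q ^ (N + 1) * fineSum q (z * q ^ (N + 1)) (c * q ^ (N + 1))) /
        ((1 - z * q ^ (N + 1)) * (1 - c * q ^ (N + 1))) := by
      rw [eq_div_iff (mul_ne_zero h1 h2), ← hf]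
      ring
    rw [ih, hg, Finset.sum_range_succ, durfeeTerm_succ]
    ring

lemma norm_fineSum_le_one {q z c : ℂ} (hq : ‖q‖ < 1) (hz : ‖z * q‖ ≤ 1 / 2)
    (hc : ‖c * q‖ ≤ 1 / 4) : ‖fineSum q z c‖ ≤ 1 := by
  have hg : HasSum (fun n : ℕ => (1 / 2 : ℝ) ^ (n + 1)) 1 := by
    simpa [pow_succ] using hasSum_geometric_two.mul_right (1 / 2 : ℝ)
  refine tsum_of_norm_bounded hg fun n => ?_
  have hP : (1 / 2 : ℝ) ^ (n + 1) ≤ ‖qPoch q (z * q) (n + 1)‖ := by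
    rw [qPoch, norm_prod]
    calc (1 / 2 : ℝ) ^ (n + 1) = ∏ _k ∈ Finset.range (n + 1), (1 / 2 : ℝ) := by simp
      _ ≤ _ := Finset.prod_le_prod (fun _ _ => by norm_num) fun k _ => by
        have h1 : ‖z * q * q ^ k‖ ≤ 1 / 2 := by
          rw [norm_mul, norm_pow]
          exact (mul_le_of_le_one_right (norm_nonneg _)
            (pow_le_one₀ (norm_nonneg _) hq.le)).trans hz
        have h2 := norm_sub_norm_le 1 (z * q * q ^ k)
        rw [norm_one] at h2
        linarith
  rw [norm_div, norm_pow, div_le_iff₀ (lt_of_lt_of_le (by positivity) hP)]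
  calc ‖c * q‖ ^ (n + 1) ≤ (1 / 4 : ℝ) ^ (n + 1) := by gcongr
    _ = (1 / 2 : ℝ) ^ (n + 1) * (1 / 2 : ℝ) ^ (n + 1) := by rw [← mul_pow]; norm_num
    _ ≤ _ := by gcongr

lemma tendsto_durfeeTerm_mul_fineSum {q : ℂ} (hq : ‖q‖ < 1) (z c : ℂ) :
    Filter.Tendsto (fun N : ℕ => durfeeTerm q z c N *
      (z * q ^ N * fineSum q (z * q ^ N) (c * q ^ N))) Filter.atTop (nhds 0) := by
  have h1 : Filter.Tendsto (fun N : ℕ => durfeeTerm q z c N * (z * q ^ N))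
      Filter.atTop (nhds 0) := by
    simpa using (summable_durfeeTerm hq z c).tendsto_atTop_zero.mul (tendsto_mul_pow_add hq z 0)
  refine squeeze_zero_norm' (a := fun N => ‖durfeeTerm q z c N * (z * q ^ N)‖) ?_
    (by simpa only [norm_zero] using h1.norm)
  have hz := (tendsto_mul_pow_add hq z 1).norm
  have hc := (tendsto_mul_pow_add hq c 1).norm
  rw [norm_zero] at hz hc
  filter_upwards [hz.eventually_le_const (show (0 : ℝ) < 1 / 2 by norm_num),
    hc.eventually_le_const (show (0 : ℝ) < 1 / 4 by norm_num)] with N hzN hcN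
  rw [pow_succ, ← mul_assoc] at hzN hcN
  rw [← mul_assoc, norm_mul (durfeeTerm q z c N * (z * q ^ N))]
  exact mul_le_of_le_one_right (norm_nonneg _) (norm_fineSum_le_one hq hzN hcN)

theorem stmt2 (q z c : ℂ) (hq : ‖q‖ < 1) (hcq : ‖c * q‖ < 1)
    (hz : ∀ n : ℕ, 1 - z * q ^ (n + 1) ≠ 0) :
    ∑' n : ℕ, (z ^ (n + 1) * c ^ (n + 1) * q ^ ((n + 1) ^ 2)) /
        (qPoch q (z * q) (n + 1) * qPoch q (c * q) (n + 1))
      = z * ∑' n : ℕ, (c * q) ^ (n + 1) / qPoch q (z * q) (n + 1) := by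
  change ∑' n : ℕ, durfeeTerm q z c (n + 1) = z * fineSum q z c
  have hs : Summable fun n : ℕ => durfeeTerm q z c (n + 1) :=
    (summable_nat_add_iff 1).2 (summable_durfeeTerm hq z c)
  have h := hs.hasSum.tendsto_sum_nat.add (tendsto_durfeeTerm_mul_fineSum hq z c)
  simp only [← mul_fineSum_eq_sum_add hq hcq hz, add_zero] at h
  exact tendsto_nhds_unique h tendsto_const_nhds
end

section
/- For every integer m and every positive integer n, one has ∑_{π ∈ D(n)} (-1)^{rank(π) + s(π) - 1} ∑_{j=1}^{s(π)} (-1)^j (ℓ(π) - s(π) + j)^m = ∑_{d | n} (-1)^d d^m, where the sum on the right runs over the positive divisors d of n and, for negative m, d^m denotes the corresponding negative integer power taken in ℚ (or ℂ). -/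
open Finset

open scoped Classical

/-- The largest part `ℓ(π)` of a partition. -/
def largestPart {n : ℕ} (p : n.Partition) : ℕ := p.parts.toFinset.sup id

/-- The smallest part `s(π)` of a partition. -/
noncomputable def smallestPart {n : ℕ} (p : n.Partition) : ℕ := sInf {j | j ∈ p.parts}

/-- The number of parts `#(π)` of a partition. -/
def numParts {n : ℕ} (p : n.Partition) : ℕ := Multiset.card p.parts

/-- `ν(j)`: the multiplicity of `j` as a part of the partition. -/
def mult {n : ℕ} (p : n.Partition) (j : ℕ) : ℕ := p.parts.count j

/-- `ν_d(π)`: the number of distinct parts of the partition. -/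
def numDistinctParts {n : ℕ} (p : n.Partition) : ℕ := p.parts.toFinset.card

/-- `D(n)`: the partitions of `n` into distinct parts. -/
def D (n : ℕ) : Finset (n.Partition) := Finset.univ.filter fun p => p.parts.Nodup

open Polynomial in
theorem X_pow_dvd_prod_one_sub_X_pow_sub_one (N : ℕ) (s : Finset ℕ) (hs : ∀ i ∈ s, N ≤ i) :
    (X : ℤ[X]) ^ N ∣ ∏ i ∈ s, (1 - X ^ i) - 1 := by
  induction s using Finset.induction_on with
  | empty => simp
  | insert a s ha ih =>
    rw [Finset.prod_insert ha]
    have h₁ := ih fun i hi => hs i (Finset.mem_insert_of_mem hi)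
    have h₂ : (X : ℤ[X]) ^ N ∣ X ^ a := pow_dvd_pow _ (hs a (Finset.mem_insert_self a s))
    have h := dvd_sub h₁ (h₂.mul_right (∏ i ∈ s, (1 - X ^ i)))
    convert h using 1
    ring

open Polynomial in
theorem one_sub_X_pow_mul_sum_eq_prod (k : ℕ) (hk : 0 < k) (N : ℕ) :
    (1 - X ^ k) * ∑ a ∈ range N, X ^ a * ∏ i ∈ Ico (a + 1) (a + k), (1 - (X : ℤ[X]) ^ i)
      = ∏ i ∈ Ico N (N + k), (1 - X ^ i) := by
  induction N with
  | zero =>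
    rw [Finset.prod_eq_prod_Ico_succ_bot (by omega)]
    simp
  | succ N ih =>
    rw [Finset.sum_range_succ, mul_add, ih, Finset.prod_eq_prod_Ico_succ_bot (by omega),
      show N + 1 + k = N + k + 1 by omega, Finset.prod_Ico_succ_top (by omega)]
    ring

open Polynomial in
theorem coeff_sum_X_pow_mul_prod (k : ℕ) (hk : 0 < k) (N n : ℕ) (hn : n < N) :
    (∑ a ∈ range N, X ^ a * ∏ i ∈ Ico (a + 1) (a + k), (1 - (X : ℤ[X]) ^ i)).coeff n
      = if k ∣ n then 1 else 0 := by
  induction n using Nat.strong_induction_on with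
  | _ n ih =>
    obtain ⟨R, hR⟩ := X_pow_dvd_prod_one_sub_X_pow_sub_one N (Ico N (N + k))
      fun i hi => (Finset.mem_Ico.1 hi).1
    rw [← one_sub_X_pow_mul_sum_eq_prod k hk N] at hR
    have h := congrArg (fun p => coeff p n) hR
    simp only [sub_mul, one_mul, coeff_sub, coeff_X_pow_mul', coeff_one, if_neg hn.not_ge] at h
    by_cases hkn : k ≤ n
    · rw [if_pos hkn, ih (n - k) (by omega) (by omega), if_neg (show n ≠ 0 by omega)] at h
      simp only [Nat.dvd_sub_iff_left hkn dvd_rfl] at h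
      linarith
    · rw [if_neg hkn] at h
      have : k ∣ n ↔ n = 0 :=
        ⟨fun hd => Nat.eq_zero_of_dvd_of_lt hd (by omega), fun h => h ▸ dvd_zero k⟩
      simp only [this]
      linarith

open Polynomial in
theorem coeff_X_pow_mul_prod_one_sub_X_pow (b n : ℕ) (s : Finset ℕ) :
    (X ^ b * ∏ i ∈ s, (1 - (X : ℤ[X]) ^ i)).coeff n
      = ∑ t ∈ s.powerset with b + ∑ i ∈ t, i = n, (-1 : ℤ) ^ t.card := by
  simp only [sub_eq_add_neg, Finset.prod_one_add, Finset.mul_sum, finsetSum_coeff,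
    Finset.sum_filter]
  refine Finset.sum_congr rfl fun t _ => ?_
  rw [Finset.prod_neg, Finset.prod_pow_eq_pow_sum, mul_left_comm, ← pow_add,
    show ((-1 : ℤ[X]) ^ t.card) = C ((-1 : ℤ) ^ t.card) by simp, coeff_C_mul, coeff_X_pow]
  simp [eq_comm]

theorem le_largestPart {n : ℕ} (p : n.Partition) {i : ℕ} (hi : i ∈ p.parts) :
    i ≤ largestPart p :=
  Finset.le_sup (f := id) (Multiset.mem_toFinset.2 hi)

theorem smallestPart_le {n : ℕ} (p : n.Partition) {i : ℕ} (hi : i ∈ p.parts) :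
    smallestPart p ≤ i :=
  Nat.sInf_le hi

theorem exists_mem_parts {n : ℕ} (hn : 0 < n) (p : n.Partition) : ∃ i, i ∈ p.parts := by
  refine Multiset.exists_mem_of_ne_zero fun h => ?_
  have := p.parts_sum
  simp [h] at this
  omega

theorem smallestPart_mem {n : ℕ} (hn : 0 < n) (p : n.Partition) : smallestPart p ∈ p.parts :=
  Nat.sInf_mem (s := {j | j ∈ p.parts}) (exists_mem_parts hn p)

theorem largestPart_mem {n : ℕ} (hn : 0 < n) (p : n.Partition) : largestPart p ∈ p.parts := by
  obtain ⟨i, hi⟩ := exists_mem_parts hn p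
  obtain ⟨j, hj, h⟩ := Finset.exists_mem_eq_sup p.parts.toFinset
    ⟨i, Multiset.mem_toFinset.2 hi⟩ id
  rw [largestPart, h]
  exact Multiset.mem_toFinset.1 hj

theorem numParts_le_largestPart {n : ℕ} {p : n.Partition} (hp : p.parts.Nodup) :
    numParts p ≤ largestPart p := by
  have h : p.parts.toFinset ⊆ Finset.Icc 1 (largestPart p) := fun i hi => by
    rw [Multiset.mem_toFinset] at hi
    exact Finset.mem_Icc.2 ⟨p.parts_pos hi, le_largestPart p hi⟩
  have := Finset.card_le_card h
  rwa [Multiset.toFinset_card_of_nodup hp, Nat.card_Icc, Nat.add_sub_cancel] at this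

theorem largestPart_eq_of_parts_eq_insert {n : ℕ} {p : n.Partition} {L : ℕ} {t : Finset ℕ}
    (h : p.parts = (insert L t).val) (ht : ∀ i ∈ t, i < L) : largestPart p = L := by
  rw [largestPart, h, Finset.val_toFinset, Finset.sup_insert]
  exact sup_eq_left.2 (Finset.sup_le fun i hi => (ht i hi).le)

theorem sum_signs_eq_coeff (k n : ℕ) (hk : 0 < k) (hn : 0 < n) :
    ∑ p ∈ D n with largestPart p < k + smallestPart p ∧ k ≤ largestPart p,
        (-1 : ℤ) ^ (numParts p + 1)
      = ∑ a ∈ range (n + 1), ∑ t ∈ (Ico (a + 1) (a + k)).powerset with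
          (a + k) + ∑ i ∈ t, i = n, (-1 : ℤ) ^ t.card := by
  rw [Finset.sum_sigma']
  refine Finset.sum_bij
    (fun p _ => ⟨largestPart p - k, p.parts.toFinset.erase (largestPart p)⟩) ?_ ?_ ?_ ?_
  · intro p hp
    simp only [D, Finset.mem_filter, Finset.mem_univ, true_and] at hp
    obtain ⟨hd, h₁, h₂⟩ := hp
    have hL := largestPart_mem hn p
    have hsum : ∑ i ∈ p.parts.toFinset, i = n := by
      refine Eq.trans ?_ p.parts_sum
      rw [Finset.sum_multiset_count]
      exact Finset.sum_congr rfl fun i hi => by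
        rw [Multiset.count_eq_one_of_mem hd (Multiset.mem_toFinset.1 hi), one_smul]
    rw [← Finset.add_sum_erase _ _ (Multiset.mem_toFinset.2 hL)] at hsum
    simp only [Finset.mem_sigma, Finset.mem_range, Finset.mem_filter, Finset.mem_powerset]
    refine ⟨by omega, fun i hi => ?_, by omega⟩
    rw [Finset.mem_erase, Multiset.mem_toFinset] at hi
    have := le_largestPart p hi.2
    have := smallestPart_le p hi.2
    have := hi.1
    rw [Finset.mem_Ico]
    omega
  · intro p hp q hq h
    simp only [D, Finset.mem_filter, Finset.mem_univ, true_and] at hp hq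
    simp only [Sigma.mk.injEq, heq_eq_eq] at h
    have hL : largestPart p = largestPart q := by omega
    have hF : p.parts.toFinset = q.parts.toFinset := by
      rw [← Finset.insert_erase (Multiset.mem_toFinset.2 (largestPart_mem hn p)), h.2, hL,
        Finset.insert_erase (Multiset.mem_toFinset.2 (largestPart_mem hn q))]
    have hV := congrArg Finset.val hF
    rw [Multiset.toFinset_val, Multiset.toFinset_val, hp.1.dedup, hq.1.dedup] at hV
    exact Nat.Partition.ext hV
  · rintro ⟨a, t⟩ h
    simp only [Finset.mem_sigma, Finset.mem_range, Finset.mem_filter, Finset.mem_powerset] at h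
    obtain ⟨ha, ht, hsum⟩ := h
    have ht' : ∀ i ∈ t, a + 1 ≤ i ∧ i < a + k := fun i hi => Finset.mem_Ico.1 (ht hi)
    have hnot : a + k ∉ t := fun hi => lt_irrefl _ (ht' _ hi).2
    let p : n.Partition :=
      { parts := (insert (a + k) t).val
        parts_pos := fun {i} hi => by
          rw [Finset.mem_val, Finset.mem_insert] at hi
          rcases hi with rfl | hi
          · exact Nat.add_pos_right a hk
          · exact (Nat.succ_pos a).trans_le (ht' i hi).1
        parts_sum := by
          rw [Finset.sum_val, Finset.sum_insert hnot]
          exact hsum }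
    have hL : largestPart p = a + k :=
      largestPart_eq_of_parts_eq_insert rfl fun i hi => (ht' i hi).2
    refine ⟨p, ?_, ?_⟩
    · simp only [D, Finset.mem_filter, Finset.mem_univ, true_and]
      refine ⟨(insert (a + k) t).nodup, ?_, by omega⟩
      have hs := smallestPart_mem hn p
      have hpos := p.parts_pos hs
      rw [show p.parts = (insert (a + k) t).val from rfl, Finset.mem_val,
        Finset.mem_insert] at hs
      rcases hs with hs | hs
      · omega
      · have := ht' _ hs
        omega
    · rw [hL, show p.parts.toFinset = insert (a + k) t by ext; simp [p],
        Finset.erase_insert hnot, Nat.add_sub_cancel]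
  · intro p hp
    simp only [D, Finset.mem_filter, Finset.mem_univ, true_and] at hp
    have hL := Multiset.mem_toFinset.2 (largestPart_mem hn p)
    rw [← Finset.card_erase_add_one hL |>.trans (Multiset.toFinset_card_of_nodup hp.1) |>.trans
      (show _ = numParts p from rfl)]
    ring

theorem sum_signs_eq_ite_dvd (k n : ℕ) (hk : 0 < k) (hkn : k ≤ n) :
    ∑ p ∈ D n with largestPart p < k + smallestPart p ∧ k ≤ largestPart p,
        (-1 : ℤ) ^ (numParts p + 1)
      = if k ∣ n then 1 else 0 := by
  rw [sum_signs_eq_coeff k n hk (hk.trans_le hkn)]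
  simp only [← coeff_X_pow_mul_prod_one_sub_X_pow]
  rw [← Polynomial.finsetSum_coeff]
  simp only [add_comm _ k, pow_add Polynomial.X k, mul_assoc]
  rw [← Finset.mul_sum, Polynomial.coeff_X_pow_mul', if_pos hkn]
  simp only [add_comm k]
  rw [coeff_sum_X_pow_mul_prod k hk (n + 1) (n - k) (by omega)]
  simp only [Nat.dvd_sub_iff_left hkn dvd_rfl]

theorem summand_eq_sum_Icc (m : ℤ) {n : ℕ} (hn : 0 < n) {p : n.Partition} (hp : p.parts.Nodup) :
    (-1 : ℂ) ^ ((largestPart p - numParts p) + smallestPart p - 1) *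
      ∑ j ∈ Finset.Icc 1 (smallestPart p),
        (-1 : ℂ) ^ j * ((largestPart p - smallestPart p + j : ℕ) : ℂ) ^ m
    = ∑ k ∈ Finset.Icc 1 n with largestPart p < k + smallestPart p ∧ k ≤ largestPart p,
        (-1 : ℂ) ^ (numParts p + 1) * ((-1 : ℂ) ^ k * (k : ℂ) ^ m) := by
  have hl := largestPart_mem hn p
  have hs := p.parts_pos (smallestPart_mem hn p)
  have hsl := smallestPart_le p hl
  have hln := Multiset.single_le_sum (fun _ _ => Nat.zero_le _) _ hl
  rw [p.parts_sum] at hln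
  have hc := numParts_le_largestPart hp
  rw [Finset.mul_sum]
  refine Finset.sum_bij (fun j _ => largestPart p - smallestPart p + j) ?_ ?_ ?_ ?_
  · intro j hj
    simp only [Finset.mem_Icc, Finset.mem_filter] at hj ⊢
    omega
  · intro i _ j _ h
    exact Nat.add_left_cancel h
  · intro k hk
    simp only [Finset.mem_Icc, Finset.mem_filter] at hk
    exact ⟨k - (largestPart p - smallestPart p), Finset.mem_Icc.2 (by omega), by omega⟩
  · intro j hj
    rw [← mul_assoc, ← mul_assoc, ← pow_add, ← pow_add]
    congr 1
    refine neg_one_pow_congr ?_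
    simp only [Nat.even_iff]
    omega

theorem stmt4 (m : ℤ) (n : ℕ) (hn : 0 < n) :
    ∑ p ∈ D n, (-1 : ℂ) ^ ((largestPart p - numParts p) + smallestPart p - 1) *
      ∑ j ∈ Finset.Icc 1 (smallestPart p),
        (-1 : ℂ) ^ j * ((largestPart p - smallestPart p + j : ℕ) : ℂ) ^ m
    = ∑ d ∈ n.divisors, (-1 : ℂ) ^ d * (d : ℂ) ^ m := by
  have hD : ∀ p ∈ D n, p.parts.Nodup := fun p hp => (Finset.mem_filter.1 hp).2
  rw [Finset.sum_congr rfl fun p hp => summand_eq_sum_Icc m hn (hD p hp)]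
  simp only [Finset.sum_filter]
  rw [Finset.sum_comm]
  have hdiv : n.divisors = (Finset.Icc 1 n).filter (· ∣ n) := by
    ext d
    simp only [Nat.mem_divisors, Finset.mem_filter, Finset.mem_Icc]
    exact ⟨fun h => ⟨⟨Nat.pos_of_dvd_of_pos h.1 hn, Nat.le_of_dvd hn h.1⟩, h.1⟩,
      fun h => ⟨h.2, hn.ne'⟩⟩
  rw [hdiv, Finset.sum_filter]
  refine Finset.sum_congr rfl fun k hk => ?_
  rw [Finset.mem_Icc] at hk
  have h := congrArg (Int.cast : ℤ → ℂ) (sum_signs_eq_ite_dvd k n hk.1 hk.2)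
  push_cast at h
  rw [← Finset.sum_filter, ← Finset.sum_mul, h, ite_mul, one_mul, zero_mul]
end
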